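/- arXiv:2507.04994 — 4 statements merged into one kernel-verified Lean document; each statement's English description precedes it below -/
import Mathlib

section
/- Suppose the default characterisation x_δ is a least element of the partial order on characterisations restricted to the framework, i.e. x ≽ x_δ for every case (x, y) ∈ D. Then the bipolar argumentation framework generated by sAA-CBR contains no spikes: for every argument a ∈ Args = D ∪ {(x_δ, δ)} there is a directed path (a finite, possibly empty, sequence of attack or support edges) from a to the default argument (x_δ, δ). -/
/- Characterisations form a type `X` with a partial order; `x_a ≻ x_b` is `x_b < x_a`.
   Outcomes are `Bool`. An argument is a pair `(x, y) : X × Bool`.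
   `sArgs D xδ δ = D ∪ {(xδ, δ)}`. -/

variable {X : Type*}

/-- The set of arguments `Args = D ∪ {(x_δ, δ)}`. -/
def sArgs [PartialOrder X] [DecidableEq X] (D : Finset (X × Bool)) (xδ : X) (δ : Bool) :
    Finset (X × Bool) :=
  insert (xδ, δ) D

/-- `(x_a, y_a)` attacks `(x_b, y_b)` iff `y_a ≠ y_b` and either (i) `x_a ≻ x_b` with no
    `(x_c, y_c) ∈ A` such that `y_c = y_a` and `x_a ≻ x_c ≻ x_b`, or (ii) `x_a = x_b`. -/
def sAttacks [PartialOrder X] [DecidableEq X] (A : Finset (X × Bool)) (a b : X × Bool) : Prop :=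
  a.2 ≠ b.2 ∧
    ((b.1 < a.1 ∧ ¬ ∃ c ∈ A, c.2 = a.2 ∧ c.1 < a.1 ∧ b.1 < c.1) ∨ a.1 = b.1)

/-- `(x_a, y_a)` supports `(x_b, y_b)` iff `y_a = y_b`, `x_a ≻ x_b`, and there is no
    `(x_c, y_c) ∈ A` with `x_a ≻ x_c ≻ x_b`. -/
def sSupports [PartialOrder X] [DecidableEq X] (A : Finset (X × Bool)) (a b : X × Bool) : Prop :=
  a.2 = b.2 ∧ b.1 < a.1 ∧ ¬ ∃ c ∈ A, c.1 < a.1 ∧ b.1 < c.1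

/-- An edge of the bipolar framework: an attack or a support between arguments of `A`. -/
def sEdge [PartialOrder X] [DecidableEq X] (A : Finset (X × Bool)) (a b : X × Bool) : Prop :=
  a ∈ A ∧ b ∈ A ∧ (sAttacks A a b ∨ sSupports A a b)

/-- An argument lying strictly above some argument has an edge to an argument strictly below it. -/
theorem exists_sEdge_of_lt [PartialOrder X] [DecidableEq X] {A : Finset (X × Bool)}
    {a d : X × Bool} (ha : a ∈ A) (hd : d ∈ A) (hda : d.1 < a.1) :
    ∃ b, b.1 < a.1 ∧ sEdge A a b := by
  classical
  obtain ⟨b, hb⟩ := Finset.exists_maximalFor Prod.fst {c ∈ A | c.1 < a.1}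
    ⟨d, Finset.mem_filter.2 ⟨hd, hda⟩⟩
  obtain ⟨hbA, hba⟩ := Finset.mem_filter.1 hb.prop
  have hmax : ∀ c ∈ A, c.1 < a.1 → ¬ b.1 < c.1 := fun c hc hca hbc =>
    hbc.not_ge (hb.le_of_le (Finset.mem_filter.2 ⟨hc, hca⟩) hbc.le)
  refine ⟨b, hba, ha, hbA, ?_⟩
  by_cases hy : a.2 = b.2
  · exact Or.inr ⟨hy, hba, fun ⟨c, hc, hca, hbc⟩ => hmax c hc hca hbc⟩
  · exact Or.inl ⟨hy, Or.inl ⟨hba, fun ⟨c, hc, _, hca, hbc⟩ => hmax c hc hca hbc⟩⟩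

/-- If the default characterisation `x_δ` is a least element (every case of the casebase has
    characterisation `≽ x_δ`), then the sAA-CBR framework contains no spikes: every argument
    has a directed path (possibly empty sequence of attack/support edges) to the default
    argument `(x_δ, δ)`. -/
theorem saacbr_no_spikes [PartialOrder X] [DecidableEq X] (D : Finset (X × Bool)) (xδ : X) (δ : Bool)
    (hleast : ∀ p ∈ D, xδ ≤ p.1) :
    ∀ a ∈ sArgs D xδ δ,
      Relation.ReflTransGen (sEdge (sArgs D xδ δ)) a (xδ, δ) := by
  intro a ha
  have hd : (xδ, δ) ∈ sArgs D xδ δ := Finset.mem_insert_self _ _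
  have hwf : (sArgs D xδ δ : Set (X × Bool)).WellFoundedOn (fun b c => b.1 < c.1) :=
    have : IsStrictOrder (X × Bool) (fun b c => b.1 < c.1) :=
      { irrefl := fun b => lt_irrefl b.1, trans := fun _ _ _ => lt_trans }
    (Finset.finite_toSet _).wellFoundedOn
  refine hwf.induction (P := fun a => Relation.ReflTransGen (sEdge (sArgs D xδ δ)) a (xδ, δ))
    (Finset.mem_coe.2 ha) fun a ha ih => ?_
  have hle : xδ ≤ a.1 := by
    rcases Finset.mem_insert.1 ha with rfl | h
    exacts [le_rfl, hleast a h]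
  rcases hle.eq_or_lt with heq | hlt
  · by_cases hy : a.2 = δ
    · rw [show a = (xδ, δ) from Prod.ext heq.symm hy]
    · exact .single ⟨ha, hd, Or.inl ⟨hy, Or.inr heq.symm⟩⟩
  · obtain ⟨b, hba, hab⟩ := exists_sEdge_of_lt ha hd hlt
    exact .head hab (ih b hab.2.1 hba)
end

section
/- Every non-default argument has an outgoing edge to a strictly less exceptional argument: if a = (x_a, y_a) ∈ Args and x_a ≻ x_δ, then there exists b = (x_b, y_b) ∈ Args with x_a ≻ x_b such that a attacks b or a supports b. -/
/- Characterisations form a type `X` with a partial order; `x_a ≻ x_b` is `x_b < x_a`.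
   Outcomes are `Bool`. An argument is a pair `(x, y) : X × Bool`.
   `sArgs D xδ δ = D ∪ {(xδ, δ)}`. -/

variable {X : Type*}

/-- In a finite set of arguments, below `a` there is a maximal-position argument whenever some
    argument lies strictly below `a`. -/
theorem exists_maximal_position_below [PartialOrder X] (A : Finset (X × Bool)) (a d : X × Bool)
    (hd : d ∈ A) (hda : d.1 < a.1) :
    ∃ b ∈ A, b.1 < a.1 ∧ ¬ ∃ c ∈ A, c.1 < a.1 ∧ b.1 < c.1 := by
  classical
  obtain ⟨b, hb⟩ := (A.filter fun c => c.1 < a.1).exists_maximalFor Prod.fst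
    ⟨d, Finset.mem_filter.2 ⟨hd, hda⟩⟩
  obtain ⟨hbA, hba⟩ := Finset.mem_filter.1 hb.1
  refine ⟨b, hbA, hba, ?_⟩
  rintro ⟨c, hcA, hca, hbc⟩
  exact hbc.not_ge (hb.2 (Finset.mem_filter.2 ⟨hcA, hca⟩) hbc.le)

/-- Every non-default argument (one with `x_a ≻ x_δ`) has an outgoing attack or support edge
    to a strictly less exceptional argument of the framework. -/
theorem saacbr_outgoing_edge [PartialOrder X] [DecidableEq X] (D : Finset (X × Bool)) (xδ : X) (δ : Bool) :
    ∀ a ∈ sArgs D xδ δ, xδ < a.1 →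
      ∃ b ∈ sArgs D xδ δ, b.1 < a.1 ∧
        (sAttacks (sArgs D xδ δ) a b ∨ sSupports (sArgs D xδ δ) a b) := by
  intro a _ ha
  obtain ⟨b, hbA, hba, hmax⟩ := exists_maximal_position_below (sArgs D xδ δ) a (xδ, δ)
    (Finset.mem_insert_self _ _) ha
  refine ⟨b, hbA, hba, ?_⟩
  by_cases hy : a.2 = b.2
  · exact Or.inr ⟨hy, hba, hmax⟩
  · exact Or.inl ⟨hy, Or.inl ⟨hba, fun ⟨c, hcA, _, hc⟩ => hmax ⟨c, hcA, hc⟩⟩⟩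
end

section
/- Secondary attacks in the sAA-CBR framework go from strictly more exceptional to strictly less exceptional arguments: if there is a (possibly empty) chain of attack edges from a = (x_a, y_a) to some argument c = (x_c, y_c), and c supports b = (x_b, y_b), then x_a ≻ x_b. -/
/- Characterisations form a type `X` with a partial order; `x_a ≻ x_b` is `x_b < x_a`.
   Outcomes are `Bool`. An argument is a pair `(x, y) : X × Bool`.
   `sArgs D xδ δ = D ∪ {(xδ, δ)}`. -/

variable {X : Type*}

/-- An attack edge of the framework (between arguments of `A`). -/
def sAtkEdge [PartialOrder X] [DecidableEq X] (A : Finset (X × Bool)) (a b : X × Bool) : Prop :=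
  a ∈ A ∧ b ∈ A ∧ sAttacks A a b

/-- An attack never goes from a less exceptional argument to a more exceptional one. -/
theorem sAttacks.fst_le [PartialOrder X] [DecidableEq X] {A : Finset (X × Bool)}
    {a b : X × Bool} (h : sAttacks A a b) : b.1 ≤ a.1 :=
  h.2.elim (fun h => h.1.le) (fun h => h.ge)

/-- Characterisations weakly decrease along a chain of attack edges. -/
theorem fst_le_of_reflTransGen_sAtkEdge [PartialOrder X] [DecidableEq X]
    {A : Finset (X × Bool)} {a c : X × Bool} (h : Relation.ReflTransGen (sAtkEdge A) a c) :
    c.1 ≤ a.1 := by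
  induction h with
  | refl => exact le_rfl
  | tail _ hbc ih => exact hbc.2.2.fst_le.trans ih

/-- Secondary attacks go from strictly more exceptional to strictly less exceptional
    arguments: if there is a (possibly empty) chain of attack edges from `a` to `c`, and
    `c` supports `b`, then `x_a ≻ x_b`. -/
theorem saacbr_secondary_attack_strict [PartialOrder X] [DecidableEq X]
    (D : Finset (X × Bool)) (xδ : X) (δ : Bool) (a b c : X × Bool)
    (ha : a ∈ sArgs D xδ δ) (hb : b ∈ sArgs D xδ δ)
    (hchain : Relation.ReflTransGen (sAtkEdge (sArgs D xδ δ)) a c)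
    (hsup : sSupports (sArgs D xδ δ) c b) :
    b.1 < a.1 := by
  exact hsup.2.1.trans_le (fst_le_of_reflTransGen_sAtkEdge hchain)
end

section
/- The union of the support relation and the strict part of the attack relation (attacks between arguments with distinct characterisations) of the sAA-CBR framework is acyclic: there is no nonempty chain of such edges from an argument a ∈ Args back to a itself. -/
/- Characterisations form a type `X` with a partial order; `x_a ≻ x_b` is `x_b < x_a`.
   Outcomes are `Bool`. An argument is a pair `(x, y) : X × Bool`.
   `sArgs D xδ δ = D ∪ {(xδ, δ)}`. -/

variable {X : Type*}

/-- An edge that is either a support or a strict attack (an attack between arguments with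
    distinct characterisations), between arguments of `A`. -/
def sStrictEdge [PartialOrder X] [DecidableEq X] (A : Finset (X × Bool)) (a b : X × Bool) : Prop :=
  a ∈ A ∧ b ∈ A ∧ (sSupports A a b ∨ (sAttacks A a b ∧ a.1 ≠ b.1))

/-- Every support and every strict attack goes from a strictly larger characterisation to a
    strictly smaller one. -/
theorem sStrictEdge.lt [PartialOrder X] [DecidableEq X] {A : Finset (X × Bool)}
    {a b : X × Bool} (h : sStrictEdge A a b) : b.1 < a.1 := by
  obtain ⟨-, -, ⟨-, hlt, -⟩ | ⟨⟨-, ⟨hlt, -⟩ | heq⟩, hne⟩⟩ := h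
  · exact hlt
  · exact hlt
  · exact absurd heq hne

/-- A nonempty chain of strict edges strictly decreases the characterisation. -/
theorem lt_of_transGen_sStrictEdge [PartialOrder X] [DecidableEq X] {A : Finset (X × Bool)}
    {a b : X × Bool} (h : Relation.TransGen (sStrictEdge A) a b) : b.1 < a.1 := by
  induction h with
  | single h => exact h.lt
  | tail _ h ih => exact h.lt.trans ih

/-- The union of the support relation and the strict part of the attack relation is
    acyclic: there is no nonempty chain of such edges from an argument back to itself. -/
theorem saacbr_strict_edges_acyclic [PartialOrder X] [DecidableEq X]
    (D : Finset (X × Bool)) (xδ : X) (δ : Bool) :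
    ∀ a ∈ sArgs D xδ δ, ¬ Relation.TransGen (sStrictEdge (sArgs D xδ δ)) a a := by
  intro a _ h
  exact lt_irrefl _ (lt_of_transGen_sStrictEdge h)
end
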